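/- Let n ≥ 1, r ≥ 0 and ρ > 0. In Euclidean space ℝⁿ, let L be the line segment from the origin to r·e₁ (where e₁ is the first standard basis vector), and let T_ρ(L) = {x ∈ ℝⁿ : dist(x, L) ≤ ρ} be its closed ρ-neighbourhood with respect to the Euclidean distance. Then the Lebesgue volume of T_ρ(L) equals the volume of the closed Euclidean ball of radius ρ in ℝⁿ plus κ_{n−1} · ρ^{n−1} · r, where κ_{n−1} is the volume of the (n−1)-dimensional Euclidean unit ball. -/

import Mathlib

open MeasureTheory Set

lemma aux_mp (m : ℕ) : MeasurePreserving
    (fun x : EuclideanSpace ℝ (Fin (m+1)) =>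
      ((x 0, WithLp.toLp 2 (fun i : Fin m => x i.succ)) : ℝ × EuclideanSpace ℝ (Fin m)))
    volume volume := by
  have h1 := PiLp.volume_preserving_ofLp (Fin (m+1))
  have h2 := volume_preserving_piFinSuccAbove (fun _ : Fin (m+1) => ℝ) 0
  have h3 := (MeasurePreserving.id (volume : Measure ℝ)).prod (PiLp.volume_preserving_toLp (Fin m))
  exact h3.comp (h2.comp h1)

lemma aux_scalar (r ρ t a : ℝ) (hr : 0 ≤ r) (hρ : 0 < ρ) (ha : 0 ≤ a) :
    (∃ θ ∈ Icc (0:ℝ) 1, (t - θ * r)^2 + a^2 ≤ ρ^2) ↔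
      (a ≤ ρ ∧ -√(ρ^2 - a^2) ≤ t ∧ t ≤ r + √(ρ^2 - a^2)) := by
  constructor
  · rintro ⟨θ, ⟨h0, h1⟩, h⟩
    have h2 := abs_le.1 (Real.abs_le_sqrt (show (t - θ * r)^2 ≤ ρ^2 - a^2 by linarith))
    have h3 : 0 ≤ θ * r := by positivity
    have h4 : θ * r ≤ r := mul_le_of_le_one_left hr h1
    exact ⟨abs_le_of_sq_le_sq' (by nlinarith [sq_nonneg (t - θ * r)]) hρ.le |>.2,
      by linarith [h2.1], by linarith [h2.2]⟩
  · rintro ⟨h1, h2, h3⟩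
    have hs : 0 ≤ ρ^2 - a^2 := by nlinarith
    have hw := Real.sq_sqrt hs
    have hw0 := Real.sqrt_nonneg (ρ^2 - a^2)
    by_cases ht : t ≤ 0
    · exact ⟨0, by simp, by nlinarith⟩
    by_cases ht' : r ≤ t
    · exact ⟨1, by simp, by nlinarith⟩
    push Not at ht ht'
    refine ⟨t / r, ⟨by positivity, (div_le_one (by linarith)).2 ht'.le⟩, ?_⟩
    rw [div_mul_cancel₀ _ (by linarith)]
    nlinarith

lemma aux_tube (m : ℕ) (r ρ : ℝ) (hr : 0 ≤ r) (hρ : 0 < ρ) (i0 : Fin (m+1)) (hi : i0 = 0) :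
    volume {x : EuclideanSpace ℝ (Fin (m+1)) |
        Metric.infDist x (segment ℝ (0 : EuclideanSpace ℝ (Fin (m+1)))
            (r • EuclideanSpace.single i0 (1 : ℝ))) ≤ ρ}
      = (∫⁻ y in Metric.closedBall (0 : EuclideanSpace ℝ (Fin m)) ρ,
          ENNReal.ofReal (2 * √(ρ^2 - ‖y‖^2)))
        + ENNReal.ofReal r * volume (Metric.closedBall (0 : EuclideanSpace ℝ (Fin m)) ρ) := by
  subst hi
  set A : Set (ℝ × EuclideanSpace ℝ (Fin m)) :=
    {p | ‖p.2‖ ≤ ρ ∧ -√(ρ^2 - ‖p.2‖^2) ≤ p.1 ∧ p.1 ≤ r + √(ρ^2 - ‖p.2‖^2)} with hA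
  have hAm : MeasurableSet A := by
    apply IsClosed.measurableSet
    have c1 : IsClosed {p : ℝ × EuclideanSpace ℝ (Fin m) | ‖p.2‖ ≤ ρ} :=
      isClosed_le (by fun_prop) (by fun_prop)
    have c2 : IsClosed {p : ℝ × EuclideanSpace ℝ (Fin m) | -√(ρ^2 - ‖p.2‖^2) ≤ p.1} :=
      isClosed_le (by fun_prop) (by fun_prop)
    have c3 : IsClosed {p : ℝ × EuclideanSpace ℝ (Fin m) | p.1 ≤ r + √(ρ^2 - ‖p.2‖^2)} :=
      isClosed_le (by fun_prop) (by fun_prop)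
    exact c1.inter (c2.inter c3)
  have hset : {x : EuclideanSpace ℝ (Fin (m+1)) |
        Metric.infDist x (segment ℝ (0 : EuclideanSpace ℝ (Fin (m+1)))
            (r • EuclideanSpace.single 0 (1 : ℝ))) ≤ ρ} =
      (fun x : EuclideanSpace ℝ (Fin (m+1)) =>
      ((x 0, WithLp.toLp 2 (fun i : Fin m => x i.succ)) : ℝ × EuclideanSpace ℝ (Fin m))) ⁻¹' A := by
    ext x
    simp only [mem_ofPred_eq, mem_preimage, hA]
    rw [← aux_scalar r ρ _ _ hr hρ (norm_nonneg _)]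
    have hseg : segment ℝ (0 : EuclideanSpace ℝ (Fin (m+1)))
            (r • EuclideanSpace.single 0 (1 : ℝ)) =
            (fun θ : ℝ => θ • (r • EuclideanSpace.single (0 : Fin (m+1)) (1 : ℝ))) '' Icc 0 1 := by
      rw [segment_eq_image]; simp
    have hd : ∀ θ : ℝ, dist x (θ • (r • EuclideanSpace.single (0 : Fin (m+1)) (1 : ℝ))) ≤ ρ ↔
        (x 0 - θ * r)^2 + ‖(WithLp.toLp 2 (fun i : Fin m => x i.succ) :
          EuclideanSpace ℝ (Fin m))‖^2 ≤ ρ^2 := by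
      intro θ
      rw [← pow_le_pow_iff_left₀ dist_nonneg hρ.le two_ne_zero, EuclideanSpace.dist_sq_eq,
        EuclideanSpace.norm_sq_eq, Fin.sum_univ_succ]
      simp [Real.dist_eq, sq_abs]
    have hc : IsCompact (segment ℝ (0 : EuclideanSpace ℝ (Fin (m+1)))
            (r • EuclideanSpace.single 0 (1 : ℝ))) := by
      rw [hseg]; exact isCompact_Icc.image (by fun_prop)
    constructor
    · intro h
      obtain ⟨p, hp, hpd⟩ := hc.exists_infDist_eq_dist ⟨0, left_mem_segment _ _ _⟩ x
      rw [hpd] at h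
      rw [hseg] at hp
      obtain ⟨θ, hθ, rfl⟩ := hp
      exact ⟨θ, hθ, (hd θ).1 h⟩
    · rintro ⟨θ, hθ, h⟩
      exact (Metric.infDist_le_dist_of_mem (by rw [hseg]; exact ⟨θ, hθ, rfl⟩)).trans ((hd θ).2 h)
  rw [hset, (aux_mp m).measure_preimage hAm.nullMeasurableSet, Measure.volume_eq_prod,
    Measure.prod_apply_symm hAm, ← setLIntegral_const, ← lintegral_add_left (by fun_prop),
    ← lintegral_indicator Metric.isClosed_closedBall.measurableSet]
  congr 1
  ext y
  by_cases hy : ‖y‖ ≤ ρ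
  · rw [indicator_of_mem (by simpa using hy)]
    have : (fun x => (x, y)) ⁻¹' A = Icc (-√(ρ^2 - ‖y‖^2)) (r + √(ρ^2 - ‖y‖^2)) := by
      ext t; simp [hA, hy]
    rw [this, Real.volume_Icc, ← ENNReal.ofReal_add (by positivity) hr]
    congr 1; ring
  · rw [indicator_of_notMem (by simpa using hy)]
    have : (fun x => (x, y)) ⁻¹' A = ∅ := by
      ext t; simp [hA, hy]
    rw [this, measure_empty]

/-- In `ℝⁿ` (n ≥ 1), the volume of the closed `ρ`-neighbourhood of the
segment from `0` to `r·e₁` equals the volume of the closed ball of radius `ρ` plus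
`κ_{n-1} · ρ^{n-1} · r`, where `κ_{n-1}` is the volume of the `(n-1)`-dimensional
Euclidean unit ball. -/
theorem stmt_3 (n : ℕ) (hn : 1 ≤ n) (r ρ : ℝ) (hr : 0 ≤ r) (hρ : 0 < ρ) :
    volume {x : EuclideanSpace ℝ (Fin n) |
        Metric.infDist x
          (segment ℝ (0 : EuclideanSpace ℝ (Fin n))
            (r • EuclideanSpace.single (⟨0, hn⟩ : Fin n) (1 : ℝ))) ≤ ρ}
      = volume (Metric.closedBall (0 : EuclideanSpace ℝ (Fin n)) ρ)
        + ENNReal.ofReal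
            ((volume (Metric.closedBall (0 : EuclideanSpace ℝ (Fin (n - 1))) 1)).toReal
              * ρ ^ (n - 1) * r) := by
  obtain ⟨m, rfl⟩ : ∃ m, n = m + 1 := ⟨n - 1, by omega⟩
  have hb : Metric.closedBall (0 : EuclideanSpace ℝ (Fin (m+1))) ρ =
      {x : EuclideanSpace ℝ (Fin (m+1)) |
        Metric.infDist x (segment ℝ (0 : EuclideanSpace ℝ (Fin (m+1)))
            ((0:ℝ) • EuclideanSpace.single 0 (1 : ℝ))) ≤ ρ} := by
    ext x
    simp [segment_same]
  rw [hb, aux_tube m r ρ hr hρ ⟨0, hn⟩ rfl, aux_tube m 0 ρ le_rfl hρ _ rfl]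
  simp only [Nat.add_sub_cancel, ENNReal.ofReal_zero, zero_mul, add_zero]
  congr 1
  rw [ENNReal.ofReal_mul (by positivity), ENNReal.ofReal_mul (by positivity),
    ENNReal.ofReal_toReal measure_closedBall_lt_top.ne,
    Measure.addHaar_closedBall' volume (0 : EuclideanSpace ℝ (Fin m)) hρ.le,
    finrank_euclideanSpace_fin]
  ring
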